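/- Let μ be a probability distribution on the k-element subsets of [n] (k ≥ 1) whose generating polynomial g_μ is log-concave, and let p be a probability distribution on [n] with p(i) > 0 for all i. Let t be an integer with t ≥ 20·k², and suppose k·p(i) ≥ (1 + 1/(20k))^{−1} · P_{S∼μ}[i ∈ S] for all i ∈ [n]. Then for every integer s ≥ 1 and every starting state S₀ ∈ supp μ, the s-step transition probabilities of M_{μ,p}^t satisfy (1/2) · ∑_{S₁} |P^s(S₀, S₁) − μ(S₁)| ≤ 2^{−s}, where P^s denotes the s-fold composition (matrix power) of the transition kernel P. -/

import Mathlib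

open Finset

/-- A probability distribution on the `k`-element subsets of `[n]`:
nonnegative, supported on `k`-element sets, summing to `1`. -/
def IsProbDistOn (n k : ℕ) (μ : Finset (Fin n) → ℝ) : Prop :=
  (∀ S, 0 ≤ μ S) ∧ (∀ S, S.card ≠ k → μ S = 0) ∧ (∑ S : Finset (Fin n), μ S = 1)

/-- The generating polynomial `g_μ(z) = ∑_{|S|=k} μ(S) ∏_{i∈S} z_i`. -/
noncomputable def genPoly (n k : ℕ) (μ : Finset (Fin n) → ℝ) (z : Fin n → ℝ) : ℝ :=
  ∑ S ∈ Finset.univ.filter (fun S : Finset (Fin n) => S.card = k), μ S * ∏ i ∈ S, z i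

/-- `g` is log-concave as a function on `ℝ_{≥0}^n`. -/
def IsLogConcaveOn (n : ℕ) (g : (Fin n → ℝ) → ℝ) : Prop :=
  ∀ x y : Fin n → ℝ, (∀ i, 0 ≤ x i) → (∀ i, 0 ≤ y i) →
    ∀ lam : ℝ, 0 < lam → lam < 1 →
      g x ^ lam * g y ^ (1 - lam) ≤ g (fun i => lam * x i + (1 - lam) * y i)

/-- The marginal `P_{S∼μ}[i ∈ S]`. -/
noncomputable def marginal (n : ℕ) (μ : Finset (Fin n) → ℝ) (i : Fin n) : ℝ :=
  ∑ S ∈ Finset.univ.filter (fun S : Finset (Fin n) => i ∈ S), μ S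

open scoped Classical

/-- The weight `w(τ,S) = μ(τ_S) · ∏_{i∈S} p(τ_i)⁻¹` for a sequence `τ ∈ [n]^r`
and an index set `S ⊆ [r]`. -/
noncomputable def wSeq (n r : ℕ) (μ : Finset (Fin n) → ℝ) (p : Fin n → ℝ)
    (τ : Fin r → Fin n) (S : Finset (Fin r)) : ℝ :=
  μ (S.image τ) * ∏ i ∈ S, (p (τ i))⁻¹

/-- The normalization constant `Z_{μ,p}(τ) = ∑_{S ∈ binom([r],k)} w(τ,S)`. -/
noncomputable def Zconst (n k r : ℕ) (μ : Finset (Fin n) → ℝ) (p : Fin n → ℝ)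
    (τ : Fin r → Fin n) : ℝ :=
  ∑ S ∈ Finset.univ.filter (fun S : Finset (Fin r) => S.card = k), wSeq n r μ p τ S

/-- The distribution `μ_{τ,p}(S) = w(τ,S)/Z_{μ,p}(τ)`, with value `0` when `Z = 0`. -/
noncomputable def muTau (n k r : ℕ) (μ : Finset (Fin n) → ℝ) (p : Fin n → ℝ)
    (τ : Fin r → Fin n) (S : Finset (Fin r)) : ℝ :=
  if Zconst n k r μ p τ = 0 then 0 else wSeq n r μ p τ S / Zconst n k r μ p τ

/-- The interleaving distribution `q_{S₀}` on `[n]^r`: draw `t = r - k` i.i.d. samples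
from `p` and permute the elements of `S₀` into the sequence uniformly at random. -/
noncomputable def interDist (n k r : ℕ) (p : Fin n → ℝ) (S₀ : Finset (Fin n))
    (τ : Fin r → Fin n) : ℝ :=
  (1 / ((Nat.factorial k : ℝ) * (r.choose k : ℝ))) *
    ∑ A ∈ Finset.univ.filter (fun A : Finset (Fin r) => A.card = k),
      ∑ b : {x // x ∈ A} → {y // y ∈ S₀},
        if Function.Bijective b ∧ ∀ i : {x // x ∈ A}, τ i.1 = (b i).1 then
          ∏ i ∈ Finset.univ \ A, p (τ i)
        else 0

/-- The transition kernel `P(S₀, S₁)` of the Markov chain `M_{μ,p}^t`, with `r = t + k`. -/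
noncomputable def kernel (n k t : ℕ) (μ : Finset (Fin n) → ℝ) (p : Fin n → ℝ)
    (S₀ S₁ : Finset (Fin n)) : ℝ :=
  ∑ τ : Fin (t + k) → Fin n,
    interDist n k (t + k) p S₀ τ *
      ∑ S ∈ Finset.univ.filter
          (fun S : Finset (Fin (t + k)) => S.card = k ∧ S.image τ = S₁),
        muTau n k (t + k) μ p τ S

/-- The transition kernel of `M_{μ,p}^t` as a matrix indexed by subsets of `[n]`. -/
noncomputable def kernelMatrix (n k t : ℕ) (μ : Finset (Fin n) → ℝ) (p : Fin n → ℝ) :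
    Matrix (Finset (Fin n)) (Finset (Fin n)) ℝ :=
  Matrix.of fun S₀ S₁ => kernel n k t μ p S₀ S₁


/-- The number of occurrences of each symbol in a sequence. -/
def occ {n m : ℕ} (τ : Fin m → Fin n) (j : Fin n) : ℕ :=
  #{i | τ i = j}

/-- The expectation of a function of the occurrence vector of `m` i.i.d. samples from `p`. -/
noncomputable def multiExp {n : ℕ} (p : Fin n → ℝ) (m : ℕ) (F : (Fin n → ℕ) → ℝ) : ℝ :=
  ∑ τ : Fin m → Fin n, (∏ i, p (τ i)) * F (occ τ)

/-- The `0`-`1` vector of a finite set. -/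
def indVec {n : ℕ} (S : Finset (Fin n)) (j : Fin n) : ℕ :=
  if j ∈ S then 1 else 0

/-- The total weight `w(τ, ·)` of the occurrences of `T` in a sequence with occurrence
vector `N`. -/
noncomputable def occWeight {n : ℕ} (μ : Finset (Fin n) → ℝ) (p : Fin n → ℝ) (N : Fin n → ℕ)
    (T : Finset (Fin n)) : ℝ :=
  μ T * ∏ j ∈ T, ((N j : ℝ) / p j)

section Multinomial

variable {n : ℕ} {p : Fin n → ℝ}

lemma occ_insertNth {m : ℕ} (i : Fin (m + 1)) (x : Fin n) (τ : Fin m → Fin n) :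
    occ (Fin.insertNth (α := fun _ => Fin n) i x τ) = occ τ + Pi.single x 1 := by
  funext j
  simp only [occ, Finset.card_filter, Pi.add_apply]
  rw [Fin.sum_univ_succAbove _ i]
  simp [Pi.single_apply, add_comm, eq_comm]

lemma multiExp_mono (hp : ∀ i, 0 < p i) (m : ℕ) {F G : (Fin n → ℕ) → ℝ}
    (h : ∀ N, F N ≤ G N) : multiExp p m F ≤ multiExp p m G :=
  Finset.sum_le_sum fun _ _ =>
    mul_le_mul_of_nonneg_left (h _) (Finset.prod_nonneg fun _ _ => (hp _).le)

lemma multiExp_const (hp1 : ∑ i, p i = 1) (m : ℕ) (a : ℝ) :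
    multiExp p m (fun _ => a) = a := by
  simp only [multiExp]
  rw [← Finset.sum_mul, ← Fintype.piFinset_univ, ← Finset.prod_univ_sum]
  simp [hp1]

lemma multiExp_add (m : ℕ) (F G : (Fin n → ℕ) → ℝ) :
    multiExp p m (fun N => F N + G N) = multiExp p m F + multiExp p m G := by
  simp only [multiExp, mul_add, Finset.sum_add_distrib]

lemma multiExp_mul_left (m : ℕ) (a : ℝ) (F : (Fin n → ℕ) → ℝ) :
    multiExp p m (fun N => a * F N) = a * multiExp p m F := by
  simp only [multiExp, Finset.mul_sum]
  exact Finset.sum_congr rfl fun _ _ => by ring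

lemma multiExp_sum {ι : Type*} (s : Finset ι) (m : ℕ) (F : ι → (Fin n → ℕ) → ℝ) :
    multiExp p m (fun N => ∑ x ∈ s, F x N) = ∑ x ∈ s, multiExp p m (F x) := by
  simp only [multiExp, Finset.mul_sum]
  exact Finset.sum_comm

/-- Size biasing of the multinomial distribution. -/
lemma multiExp_occ_mul (m : ℕ) (j : Fin n) (F : (Fin n → ℕ) → ℝ) :
    multiExp p (m + 1) (fun N => (N j : ℝ) * F N) =
      ((m + 1 : ℕ) : ℝ) * p j * multiExp p m (fun N => F (N + Pi.single j 1)) := by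
  have key : ∀ i : Fin (m + 1),
      ∑ τ : Fin (m + 1) → Fin n, (∏ l, p (τ l)) * ((if τ i = j then 1 else 0) * F (occ τ)) =
        p j * multiExp p m (fun N => F (N + Pi.single j 1)) := by
    intro i
    rw [← (Fin.insertNthEquiv (fun _ => Fin n) i).sum_comp, Fintype.sum_prod_type,
      Finset.sum_eq_single j]
    · simp only [multiExp, Finset.mul_sum]
      refine Finset.sum_congr rfl fun τ _ => ?_
      rw [Fin.prod_univ_succAbove _ i,
        show (Fin.insertNthEquiv (fun _ => Fin n) i) (j, τ) =
          Fin.insertNth (α := fun _ => Fin n) i j τ from rfl, occ_insertNth]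
      simp [mul_assoc]
    · intro x _ hx
      simp [hx]
    · simp
  have hN : ∀ τ : Fin (m + 1) → Fin n,
      (occ τ j : ℝ) = ∑ i, (if τ i = j then (1 : ℝ) else 0) := by
    intro τ
    simp [occ]
  calc multiExp p (m + 1) (fun N => (N j : ℝ) * F N)
      = ∑ i : Fin (m + 1), ∑ τ : Fin (m + 1) → Fin n,
          (∏ l, p (τ l)) * ((if τ i = j then 1 else 0) * F (occ τ)) := by
        rw [Finset.sum_comm]
        simp only [multiExp, hN, Finset.sum_mul, Finset.mul_sum]
    _ = _ := by
        simp only [key, Finset.sum_const, Finset.card_univ, Fintype.card_fin, nsmul_eq_mul]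
        ring

/-- Size biasing by a product of distinct occurrence counts. -/
lemma multiExp_prod_occ_mul (S : Finset (Fin n)) (m : ℕ) (F : (Fin n → ℕ) → ℝ) :
    multiExp p (m + #S) (fun N => (∏ j ∈ S, (N j : ℝ)) * F N) =
      ((m + #S).descFactorial #S : ℝ) * (∏ j ∈ S, p j) *
        multiExp p m (fun N => F (N + indVec S)) := by
  induction S using Finset.induction_on generalizing F with
  | empty =>
    have : (indVec (∅ : Finset (Fin n))) = 0 := by funext j; simp [indVec]
    simp [this]
  | insert a S ha ih =>
    rw [Finset.card_insert_of_notMem ha, ← add_assoc]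
    simp only [Finset.prod_insert ha, mul_assoc]
    rw [multiExp_occ_mul]
    have h1 : ∀ N : Fin n → ℕ, ∏ j ∈ S, (((N + Pi.single a 1 : Fin n → ℕ) j : ℕ) : ℝ) = ∏ j ∈ S, (N j : ℝ) := by
      intro N
      refine Finset.prod_congr rfl fun j hj => ?_
      have : j ≠ a := by rintro rfl; exact ha hj
      simp [this]
    have h2 : ∀ N : Fin n → ℕ, N + indVec (insert a S) = N + indVec S + Pi.single a 1 := by
      intro N
      funext j
      by_cases h : j = a
      · subst h; simp [indVec, ha]
      · simp [indVec, h]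
    simp only [h1, h2]
    rw [ih, Nat.succ_descFactorial_succ]
    push_cast
    ring

/-- Negative dependence of the multinomial distribution. -/
lemma multiExp_prod_add_le (hp : ∀ i, 0 < p i) (hp1 : ∑ i, p i = 1) (a : Fin n → ℕ)
    (T : Finset (Fin n)) (m : ℕ) :
    multiExp p m (fun N => ∏ j ∈ T, (((N + a) j : ℕ) : ℝ)) ≤
      ∏ j ∈ T, ((m : ℝ) * p j + a j) := by
  induction T using Finset.induction_on generalizing m with
  | empty => simp [multiExp_const hp1]
  | insert x T hx ih =>
    simp only [Finset.prod_insert hx]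
    have hsplit : (fun N : Fin n → ℕ => (((N + a) x : ℕ) : ℝ) * ∏ j ∈ T, (((N + a) j : ℕ) : ℝ)) =
        fun N => (N x : ℝ) * (∏ j ∈ T, (((N + a) j : ℕ) : ℝ)) +
          (a x : ℝ) * ∏ j ∈ T, (((N + a) j : ℕ) : ℝ) := by
      funext N
      simp only [Pi.add_apply]
      push_cast
      ring
    rw [hsplit, multiExp_add, multiExp_mul_left, add_mul]
    refine add_le_add ?_ (mul_le_mul_of_nonneg_left (ih m) (Nat.cast_nonneg _))
    cases m with
    | zero => simp [multiExp, occ]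
    | succ m =>
      rw [multiExp_occ_mul]
      refine mul_le_mul_of_nonneg_left ?_ (mul_nonneg (Nat.cast_nonneg _) (hp x).le)
      have h1 : ∀ N : Fin n → ℕ, ∏ j ∈ T, (((N + Pi.single x 1 + a : Fin n → ℕ) j : ℕ) : ℝ) =
          ∏ j ∈ T, (((N + a) j : ℕ) : ℝ) := by
        intro N
        refine Finset.prod_congr rfl fun j hj => ?_
        have : j ≠ x := by rintro rfl; exact hx hj
        simp [this]
      simp only [h1]
      refine (ih m).trans (Finset.prod_le_prod ?_ ?_)
      · intro j _
        have := (hp j).le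
        positivity
      · intro j _
        have := (hp j).le
        push_cast
        nlinarith

/-- Jensen's inequality for the reciprocal of a positive function. -/
lemma inv_le_multiExp_inv (hp : ∀ i, 0 < p i) (hp1 : ∑ i, p i = 1) (m : ℕ)
    {F : (Fin n → ℕ) → ℝ} (hF : ∀ N, 0 < F N) {M : ℝ} (hM : 0 < M)
    (hFM : multiExp p m F ≤ M) : M⁻¹ ≤ multiExp p m (fun N => (F N)⁻¹) := by
  have h1 : multiExp p m (fun N => 2 * M⁻¹ + (-(M⁻¹ ^ 2)) * F N) ≤
      multiExp p m (fun N => (F N)⁻¹) := by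
    refine multiExp_mono hp m fun N => ?_
    have hN := hF N
    have : (F N)⁻¹ - (2 * M⁻¹ + (-(M⁻¹ ^ 2)) * F N) = (F N - M) ^ 2 / (F N * M ^ 2) := by
      field_simp
      ring
    have h2 : 0 ≤ (F N - M) ^ 2 / (F N * M ^ 2) := by positivity
    linarith
  rw [multiExp_add, multiExp_const hp1, multiExp_mul_left] at h1
  refine le_trans ?_ h1
  have h2 : M⁻¹ ^ 2 * multiExp p m F ≤ M⁻¹ ^ 2 * M := by gcongr
  have h3 : M⁻¹ ^ 2 * M = M⁻¹ := by field_simp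
  linarith

end Multinomial

section Kernel

variable {n : ℕ}

lemma card_filter_image_eq {r : ℕ} (τ : Fin r → Fin n) (T : Finset (Fin n)) :
    #{S : Finset (Fin r) | #S = #T ∧ S.image τ = T} = ∏ j ∈ T, occ τ j := by
  have h : ∏ j ∈ T, occ τ j = #(T.pi fun j => ({i | τ i = j} : Finset (Fin r))) := by
    rw [Finset.card_pi]; rfl
  rw [h]
  symm
  refine Finset.card_bij (fun φ _ => T.attach.image fun j => φ j.1 j.2) ?_ ?_ ?_
  · intro φ hφ
    simp only [Finset.mem_pi, Finset.mem_filter, Finset.mem_univ, true_and] at hφ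
    simp only [Finset.mem_filter, Finset.mem_univ, true_and]
    constructor
    · rw [Finset.card_image_of_injective, Finset.card_attach]
      intro a b hab
      have := congrArg τ hab
      simp only [hφ] at this
      exact Subtype.ext this
    · ext j
      simp only [Finset.mem_image, Finset.mem_attach, true_and, Subtype.exists]
      constructor
      · rintro ⟨i, ⟨a, ha, rfl⟩, rfl⟩
        rwa [hφ]
      · intro hj
        exact ⟨φ j hj, ⟨j, hj, rfl⟩, hφ j hj⟩
  · intro φ hφ ψ hψ heq
    simp only [Finset.mem_pi, Finset.mem_filter, Finset.mem_univ, true_and] at hφ hψ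
    funext j hj
    have : φ j hj ∈ T.attach.image fun j => ψ j.1 j.2 := by
      rw [← heq]
      exact Finset.mem_image.2 ⟨⟨j, hj⟩, Finset.mem_attach _ _, rfl⟩
    obtain ⟨⟨l, hl⟩, _, h2⟩ := Finset.mem_image.1 this
    have h3 := congrArg τ h2
    simp only [hφ, hψ] at h3
    subst h3
    exact h2.symm
  · intro S hS
    simp only [Finset.mem_filter, Finset.mem_univ, true_and] at hS
    obtain ⟨hc, rfl⟩ := hS
    have hinj : Set.InjOn τ S := Finset.card_image_iff.1 hc.symm
    have hex : ∀ j, j ∈ S.image τ → ∃ i ∈ S, τ i = j := fun j hj => Finset.mem_image.1 hj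
    choose φ h1 h2 using hex
    refine ⟨φ, by simp [Finset.mem_pi, h2], ?_⟩
    ext i
    simp only [Finset.mem_image, Finset.mem_attach, true_and, Subtype.exists]
    constructor
    · rintro ⟨a, ha, rfl⟩
      exact h1 a _
    · intro hi
      have hj : τ i ∈ S.image τ := Finset.mem_image_of_mem _ hi
      refine ⟨τ i, Finset.mem_image.1 hj, hinj (h1 _ hj) hi (h2 _ hj)⟩

variable {k : ℕ} {μ : Finset (Fin n) → ℝ} {p : Fin n → ℝ}

lemma sum_wSeq_image_eq (hμ : ∀ S, #S ≠ k → μ S = 0) {r : ℕ} (τ : Fin r → Fin n)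
    (T : Finset (Fin n)) :
    ∑ S : Finset (Fin r) with #S = k ∧ S.image τ = T, wSeq n r μ p τ S =
      occWeight μ p (occ τ) T := by
  by_cases hT : #T = k
  · subst hT
    have h : ∀ S ∈ ({S | #S = #T ∧ S.image τ = T} : Finset (Finset (Fin r))),
        wSeq n r μ p τ S = μ T * ∏ j ∈ T, (p j)⁻¹ := by
      intro S hS
      simp only [Finset.mem_filter, Finset.mem_univ, true_and] at hS
      obtain ⟨hc, rfl⟩ := hS
      rw [wSeq, Finset.prod_image (Finset.card_image_iff.1 hc.symm)]
    rw [Finset.sum_congr rfl h, Finset.sum_const, card_filter_image_eq, occWeight]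
    simp only [div_eq_mul_inv, Finset.prod_mul_distrib, nsmul_eq_mul]
    push_cast
    ring
  · rw [occWeight, hμ T hT, zero_mul]
    refine Finset.sum_eq_zero fun S hS => ?_
    simp only [Finset.mem_filter, Finset.mem_univ, true_and] at hS
    rw [wSeq, hS.2, hμ T hT, zero_mul]

lemma Zconst_eq (hμ : ∀ S, #S ≠ k → μ S = 0) {r : ℕ} (τ : Fin r → Fin n) :
    Zconst n k r μ p τ = ∑ T, occWeight μ p (occ τ) T := by
  rw [Zconst, ← Finset.sum_fiberwise _ (fun S => S.image τ)]
  refine Finset.sum_congr rfl fun T _ => ?_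
  rw [Finset.filter_filter, sum_wSeq_image_eq hμ]

lemma sum_muTau_image_eq (hμ : ∀ S, #S ≠ k → μ S = 0) {r : ℕ} (τ : Fin r → Fin n)
    (T : Finset (Fin n)) :
    ∑ S : Finset (Fin r) with #S = k ∧ S.image τ = T, muTau n k r μ p τ S =
      occWeight μ p (occ τ) T / ∑ T', occWeight μ p (occ τ) T' := by
  have h : ∀ S, muTau n k r μ p τ S = wSeq n r μ p τ S / Zconst n k r μ p τ := by
    intro S
    rw [muTau]
    split_ifs with h
    · rw [h, div_zero]
    · rfl
  simp only [h]
  rw [← Finset.sum_div, sum_wSeq_image_eq hμ, Zconst_eq hμ]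

lemma interDist_eq (hp : ∀ i, 0 < p i) {r : ℕ} {S₀ : Finset (Fin n)} (hS₀ : #S₀ = k)
    (τ : Fin r → Fin n) :
    interDist n k r p S₀ τ = (1 / ((k.factorial : ℝ) * (r.choose k : ℝ))) *
      ((∏ i, p (τ i)) * ∏ j ∈ S₀, ((occ τ j : ℝ) / p j)) := by
  subst hS₀
  rw [interDist]
  congr 1
  have h : ∀ A : Finset (Fin r), #A = #S₀ →
      (∑ b : {x // x ∈ A} → {y // y ∈ S₀},
        if Function.Bijective b ∧ ∀ i : {x // x ∈ A}, τ i.1 = (b i).1 then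
          ∏ i ∈ Finset.univ \ A, p (τ i) else 0) =
      if A.image τ = S₀ then (∏ i, p (τ i)) * ∏ j ∈ S₀, (p j)⁻¹ else 0 := by
    intro A hA
    split_ifs with him
    · have hmem : ∀ i : {x // x ∈ A}, τ i.1 ∈ S₀ := fun i => by
        rw [← him]; exact Finset.mem_image_of_mem _ i.2
      have hinj : Set.InjOn τ A := Finset.card_image_iff.1 (by rw [him, hA])
      rw [Finset.sum_eq_single (fun i => ⟨τ i.1, hmem i⟩)]
      · rw [if_pos]
        · have h1 : ∏ j ∈ S₀, (p j)⁻¹ = ∏ i ∈ A, (p (τ i))⁻¹ := by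
            rw [← him, Finset.prod_image hinj]
          rw [h1, ← Finset.prod_sdiff (Finset.subset_univ A), mul_assoc,
            ← Finset.prod_mul_distrib]
          simp [(hp _).ne']
        · refine ⟨⟨fun a b hab => ?_, ?_⟩, fun _ => rfl⟩
          · exact Subtype.ext (hinj a.2 b.2 (by simpa using hab))
          · rintro ⟨y, hy⟩
            rw [← him] at hy
            obtain ⟨i, hi, rfl⟩ := Finset.mem_image.1 hy
            exact ⟨⟨i, hi⟩, rfl⟩
      · intro b _ hb
        rw [if_neg]
        rintro ⟨_, hb'⟩
        exact hb (funext fun i => Subtype.ext (hb' i).symm)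
      · simp
    · refine Finset.sum_eq_zero fun b _ => if_neg ?_
      rintro ⟨hbij, hb⟩
      apply him
      ext y
      simp only [Finset.mem_image]
      constructor
      · rintro ⟨i, hi, rfl⟩
        rw [hb ⟨i, hi⟩]
        exact (b ⟨i, hi⟩).2
      · intro hy
        obtain ⟨i, hi⟩ := hbij.2 ⟨y, hy⟩
        exact ⟨i.1, i.2, by rw [hb i, hi]⟩
  rw [Finset.sum_congr rfl fun A hA => h A (Finset.mem_filter.1 hA).2, ← Finset.sum_filter,
    Finset.filter_filter, Finset.sum_const, card_filter_image_eq]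
  simp only [div_eq_mul_inv, Finset.prod_mul_distrib, nsmul_eq_mul]
  push_cast
  ring

lemma kernel_eq_sum (hμ : ∀ S, #S ≠ k → μ S = 0) (hp : ∀ i, 0 < p i) (t : ℕ)
    {S₀ : Finset (Fin n)} (hS₀ : #S₀ = k) (S₁ : Finset (Fin n)) :
    kernel n k t μ p S₀ S₁ = (1 / ((k.factorial : ℝ) * ((t + k).choose k : ℝ))) *
      multiExp p (t + k) (fun N => (∏ j ∈ S₀, ((N j : ℝ) / p j)) *
        (occWeight μ p N S₁ / ∑ T, occWeight μ p N T)) := by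
  rw [kernel, multiExp, Finset.mul_sum]
  refine Finset.sum_congr rfl fun τ _ => ?_
  rw [interDist_eq hp hS₀, sum_muTau_image_eq hμ]
  ring

/-- Detailed balance. -/
lemma kernel_reversible (hμ : ∀ S, #S ≠ k → μ S = 0) (hp : ∀ i, 0 < p i) (t : ℕ)
    {S₀ S₁ : Finset (Fin n)} (hS₀ : #S₀ = k) (hS₁ : #S₁ = k) :
    μ S₀ * kernel n k t μ p S₀ S₁ = μ S₁ * kernel n k t μ p S₁ S₀ := by
  rw [kernel_eq_sum hμ hp t hS₀, kernel_eq_sum hμ hp t hS₁, mul_left_comm,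
    mul_left_comm (μ S₁), ← multiExp_mul_left _ (μ S₀), ← multiExp_mul_left _ (μ S₁)]
  congr 2
  funext N
  simp only [occWeight]
  ring

lemma kernel_eq_multiExp (hμ : ∀ S, #S ≠ k → μ S = 0) (hp : ∀ i, 0 < p i) (t : ℕ)
    {S₀ : Finset (Fin n)} (hS₀ : #S₀ = k) (S₁ : Finset (Fin n)) :
    kernel n k t μ p S₀ S₁ = multiExp p t (fun N =>
      occWeight μ p (N + indVec S₀) S₁ / ∑ T, occWeight μ p (N + indVec S₀) T) := by
  rw [kernel_eq_sum hμ hp t hS₀]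
  subst hS₀
  have h : (fun N : Fin n → ℕ => (∏ j ∈ S₀, ((N j : ℝ) / p j)) *
        (occWeight μ p N S₁ / ∑ T, occWeight μ p N T)) =
      fun N => (∏ j ∈ S₀, (N j : ℝ)) * ((∏ j ∈ S₀, p j)⁻¹ *
        (occWeight μ p N S₁ / ∑ T, occWeight μ p N T)) := by
    funext N
    rw [Finset.prod_div_distrib]
    ring
  rw [h, multiExp_prod_occ_mul, multiExp_mul_left, Nat.descFactorial_eq_factorial_mul_choose]
  have h1 : (∏ j ∈ S₀, p j) ≠ 0 := (Finset.prod_pos fun j _ => hp j).ne'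
  have h2 : ((t + #S₀).choose #S₀ : ℝ) ≠ 0 :=
    Nat.cast_ne_zero.2 (Nat.choose_pos (Nat.le_add_left _ _)).ne'
  have h3 : ((#S₀).factorial : ℝ) ≠ 0 := Nat.cast_ne_zero.2 (Nat.factorial_ne_zero _)
  push_cast
  field_simp

lemma occWeight_nonneg (hμ0 : ∀ S, 0 ≤ μ S) (hp : ∀ i, 0 < p i) (N : Fin n → ℕ)
    (T : Finset (Fin n)) : 0 ≤ occWeight μ p N T :=
  mul_nonneg (hμ0 T) (Finset.prod_nonneg fun j _ => div_nonneg (Nat.cast_nonneg _) (hp j).le)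

lemma sum_occWeight_pos (hμ0 : ∀ S, 0 ≤ μ S) (hp : ∀ i, 0 < p i) {S₀ : Finset (Fin n)}
    (hS₀ : μ S₀ ≠ 0) (N : Fin n → ℕ) : 0 < ∑ T, occWeight μ p (N + indVec S₀) T := by
  refine Finset.sum_pos' (fun T _ => occWeight_nonneg hμ0 hp _ T) ⟨S₀, Finset.mem_univ _, ?_⟩
  refine mul_pos (lt_of_le_of_ne (hμ0 _) hS₀.symm) (Finset.prod_pos fun j hj => ?_)
  refine div_pos ?_ (hp j)
  simp only [Pi.add_apply, indVec, if_pos hj]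
  positivity

lemma sum_kernel (hμ0 : ∀ S, 0 ≤ μ S) (hμ : ∀ S, #S ≠ k → μ S = 0) (hp : ∀ i, 0 < p i)
    (hp1 : ∑ i, p i = 1) (t : ℕ) {S₀ : Finset (Fin n)} (hS₀ : μ S₀ ≠ 0) :
    ∑ S₁, kernel n k t μ p S₀ S₁ = 1 := by
  have hc : #S₀ = k := by_contra fun h => hS₀ (hμ _ h)
  simp only [kernel_eq_multiExp hμ hp t hc]
  rw [← multiExp_sum]
  simp only [← Finset.sum_div, div_self (sum_occWeight_pos hμ0 hp hS₀ _).ne']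
  exact multiExp_const hp1 t 1

lemma kernel_eq_zero (hμ : ∀ S, #S ≠ k → μ S = 0) (hp : ∀ i, 0 < p i) (t : ℕ)
    {S₀ S₁ : Finset (Fin n)} (hS₀ : μ S₀ ≠ 0) (hS₁ : μ S₁ = 0) :
    kernel n k t μ p S₀ S₁ = 0 := by
  have hc : #S₀ = k := by_contra fun h => hS₀ (hμ _ h)
  rw [kernel_eq_multiExp hμ hp t hc]
  simp [occWeight, hS₁, multiExp]

lemma sum_mul_kernel (hμ0 : ∀ S, 0 ≤ μ S) (hμ : ∀ S, #S ≠ k → μ S = 0) (hp : ∀ i, 0 < p i)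
    (hp1 : ∑ i, p i = 1) (t : ℕ) (S₁ : Finset (Fin n)) :
    ∑ S₀, μ S₀ * kernel n k t μ p S₀ S₁ = μ S₁ := by
  by_cases hS₁ : μ S₁ = 0
  · rw [hS₁]
    refine Finset.sum_eq_zero fun S₀ _ => ?_
    by_cases hS₀ : μ S₀ = 0
    · rw [hS₀, zero_mul]
    · rw [kernel_eq_zero hμ hp t hS₀ hS₁, mul_zero]
  · have hc : #S₁ = k := by_contra fun h => hS₁ (hμ _ h)
    have h : ∀ S₀, μ S₀ * kernel n k t μ p S₀ S₁ = μ S₁ * kernel n k t μ p S₁ S₀ := by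
      intro S₀
      by_cases hS₀ : μ S₀ = 0
      · rw [hS₀, kernel_eq_zero hμ hp t hS₁ hS₀]; simp
      · exact kernel_reversible hμ hp t (by_contra fun h => hS₀ (hμ _ h)) hc
    simp only [h]
    rw [← Finset.mul_sum, sum_kernel hμ0 hμ hp hp1 t hS₁, mul_one]

/-- A lower bound on transition probabilities in terms of the generating polynomial. -/
lemma mul_le_kernel (hμ0 : ∀ S, 0 ≤ μ S) (hμ : ∀ S, #S ≠ k → μ S = 0) (hp : ∀ i, 0 < p i)
    (hp1 : ∑ i, p i = 1) (m : ℕ) (hm : 0 < m) {S₀ S₁ : Finset (Fin n)} (hS₀ : μ S₀ ≠ 0)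
    (hS₁ : μ S₁ ≠ 0) {C : ℝ} (hC : 0 < C)
    (hg : genPoly n k μ (fun i => 1 + ((indVec S₀ + indVec S₁) i : ℕ) / ((m : ℝ) * p i)) ≤ C) :
    μ S₁ * C⁻¹ ≤ kernel n k (m + k) μ p S₀ S₁ := by
  have hc₀ : #S₀ = k := by_contra fun h => hS₀ (hμ _ h)
  have hc₁ : #S₁ = k := by_contra fun h => hS₁ (hμ _ h)
  have hmR : (0 : ℝ) < m := Nat.cast_pos.2 hm
  have hprod : 0 < ∏ j ∈ S₁, p j := Finset.prod_pos fun j _ => hp j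
  have hZ := sum_occWeight_pos (p := p) hμ0 hp hS₀
  have hZ' : ∀ N : Fin n → ℕ,
      0 < ∑ T, occWeight μ p (N + indVec S₁ + indVec S₀) T := fun N => hZ _
  have hEZ : multiExp p m (fun N => ∑ T, occWeight μ p (N + indVec S₁ + indVec S₀) T) ≤
      (m : ℝ) ^ k * C := by
    rw [multiExp_sum]
    refine le_trans ?_ (mul_le_mul_of_nonneg_left hg (by positivity))
    rw [genPoly, Finset.sum_filter, Finset.mul_sum]
    refine Finset.sum_le_sum fun T _ => ?_
    split_ifs with hT
    · have h1 : (fun N : Fin n → ℕ => occWeight μ p (N + indVec S₁ + indVec S₀) T) =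
          fun N => (μ T * ∏ j ∈ T, (p j)⁻¹) *
            ∏ j ∈ T, (((N + (indVec S₀ + indVec S₁)) j : ℕ) : ℝ) := by
        funext N
        rw [occWeight, mul_assoc, ← Finset.prod_mul_distrib]
        congr 1
        refine Finset.prod_congr rfl fun j _ => ?_
        simp only [Pi.add_apply]
        push_cast
        ring
      rw [h1, multiExp_mul_left]
      have h2 : (m : ℝ) ^ k * (μ T * ∏ i ∈ T,
            (1 + ((indVec S₀ + indVec S₁) i : ℕ) / ((m : ℝ) * p i))) =
          (μ T * ∏ j ∈ T, (p j)⁻¹) *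
            ∏ j ∈ T, ((m : ℝ) * p j + ((indVec S₀ + indVec S₁) j : ℕ)) := by
        rw [mul_assoc (μ T), ← Finset.prod_mul_distrib, ← hT, ← Finset.prod_const,
          mul_left_comm, ← Finset.prod_mul_distrib]
        congr 1
        refine Finset.prod_congr rfl fun j _ => ?_
        have := (hp j).ne'
        field_simp
      rw [h2]
      refine mul_le_mul_of_nonneg_left (multiExp_prod_add_le hp hp1 _ _ _) ?_
      exact mul_nonneg (hμ0 _) (Finset.prod_nonneg fun j _ => (inv_pos.2 (hp j)).le)
    · simp [occWeight, hμ T hT, multiExp]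
  have hJ := inv_le_multiExp_inv hp hp1 m hZ' (M := (m : ℝ) ^ k * C) (by positivity) hEZ
  rw [kernel_eq_multiExp hμ hp _ hc₀]
  have hlow : multiExp p (m + k) (fun N => (∏ j ∈ S₁, (N j : ℝ)) *
        ((μ S₁ * (∏ j ∈ S₁, p j)⁻¹) * (∑ T, occWeight μ p (N + indVec S₀) T)⁻¹)) ≤
      multiExp p (m + k) (fun N =>
        occWeight μ p (N + indVec S₀) S₁ / ∑ T, occWeight μ p (N + indVec S₀) T) := by
    refine multiExp_mono hp _ fun N => ?_
    rw [div_eq_mul_inv, ← mul_assoc]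
    refine mul_le_mul_of_nonneg_right ?_ (inv_pos.2 (hZ N)).le
    rw [occWeight, Finset.prod_div_distrib, div_eq_mul_inv]
    have h1 : ∏ j ∈ S₁, (N j : ℝ) ≤ ∏ j ∈ S₁, (((N + indVec S₀) j : ℕ) : ℝ) := by
      refine Finset.prod_le_prod (fun _ _ => Nat.cast_nonneg _) fun j _ => ?_
      exact_mod_cast Nat.le_add_right _ _
    calc _ = (μ S₁ * (∏ j ∈ S₁, p j)⁻¹) * ∏ j ∈ S₁, (N j : ℝ) := by ring
      _ ≤ (μ S₁ * (∏ j ∈ S₁, p j)⁻¹) * ∏ j ∈ S₁, (((N + indVec S₀) j : ℕ) : ℝ) :=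
        mul_le_mul_of_nonneg_left h1 (mul_nonneg (hμ0 _) (inv_pos.2 hprod).le)
      _ = _ := by ring
  refine le_trans ?_ hlow
  rw [← hc₁, multiExp_prod_occ_mul, multiExp_mul_left, hc₁]
  have hdesc : (m : ℝ) ^ k ≤ ((m + k).descFactorial k : ℝ) := by
    have h1 := Nat.pow_sub_le_descFactorial (m + k) k
    have h2 : m ^ k ≤ (m + k + 1 - k) ^ k := Nat.pow_le_pow_left (by omega) _
    exact_mod_cast h2.trans h1
  calc μ S₁ * C⁻¹ = (m : ℝ) ^ k * (μ S₁ * ((m : ℝ) ^ k * C)⁻¹) := by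
        field_simp
    _ ≤ ((m + k).descFactorial k : ℝ) * (μ S₁ * multiExp p m
          (fun N => (∑ T, occWeight μ p (N + indVec S₁ + indVec S₀) T)⁻¹)) := by
        have := hμ0 S₁
        gcongr
    _ = _ := by
        field_simp

end Kernel

section LogConcave

variable {n k : ℕ} {μ : Finset (Fin n) → ℝ}

lemma genPoly_one (hμ : IsProbDistOn n k μ) : genPoly n k μ (fun _ => 1) = 1 := by
  obtain ⟨_, h1, h2⟩ := hμ
  rw [genPoly, Finset.sum_filter]
  refine Eq.trans ?_ h2
  refine Finset.sum_congr rfl fun S _ => ?_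
  split_ifs with h
  · simp
  · exact (h1 S h).symm

lemma hasDerivAt_genPoly_line (hμ : IsProbDistOn n k μ) (v : Fin n → ℝ) :
    HasDerivAt (fun x : ℝ => genPoly n k μ (fun i => 1 + x * v i))
      (∑ i, marginal n μ i * v i) 0 := by
  have h1 : ∀ S : Finset (Fin n),
      HasDerivAt (fun x : ℝ => ∏ i ∈ S, (1 + x * v i)) (∑ i ∈ S, v i) 0 := by
    intro S
    have := HasDerivAt.fun_finsetProd (u := S) (f := fun i (x : ℝ) => 1 + x * v i)
      (f' := v) (x := 0) (fun i _ => by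
        simpa using ((hasDerivAt_id (0 : ℝ)).mul_const (v i)).const_add 1)
    simpa using this
  have h2 : HasDerivAt (fun x : ℝ => genPoly n k μ (fun i => 1 + x * v i))
      (∑ S : Finset (Fin n) with #S = k, μ S * ∑ i ∈ S, v i) 0 :=
    HasDerivAt.fun_sum fun S _ => (h1 S).const_mul (μ S)
  convert h2 using 1
  rw [Finset.sum_filter]
  simp only [marginal, Finset.sum_mul, Finset.sum_filter]
  rw [Finset.sum_comm]
  refine Finset.sum_congr rfl fun S _ => ?_
  split_ifs with h
  · simp [Finset.mul_sum, ite_mul]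
  · simp [hμ.2.1 S h]

lemma genPoly_one_add_le_exp (hμ : IsProbDistOn n k μ) (hlc : IsLogConcaveOn n (genPoly n k μ))
    {v : Fin n → ℝ} (hv : ∀ i, 0 ≤ v i) :
    genPoly n k μ (fun i => 1 + v i) ≤ Real.exp (∑ i, marginal n μ i * v i) := by
  set G := genPoly n k μ (fun i => 1 + v i) with hG
  rcases le_or_gt G 0 with h0 | h0
  · exact h0.trans (Real.exp_pos _).le
  rw [← Real.log_le_iff_le_exp h0]
  have hd := (hasDerivAt_genPoly_line hμ v).tendsto_slope_zero_right
  refine ge_of_tendsto hd ?_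
  filter_upwards [Ioo_mem_nhdsGT (zero_lt_one' ℝ)] with x hx
  have h1 := hlc (fun i => 1 + v i) (fun _ => 1) (fun i => by linarith [hv i])
    (fun _ => zero_le_one) x hx.1 hx.2
  rw [← hG, genPoly_one hμ, Real.one_rpow, mul_one] at h1
  have h2 : (fun i => x * (1 + v i) + (1 - x) * 1) = fun i => 1 + x * v i := by
    funext i; ring
  rw [h2] at h1
  have h3 : 1 + x * Real.log G ≤ G ^ x := by
    rw [Real.rpow_def_of_pos h0]
    have := Real.add_one_le_exp (Real.log G * x)
    linarith
  simp only [zero_add, zero_mul, add_zero, smul_eq_mul, genPoly_one hμ]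
  rw [← div_eq_inv_mul, le_div_iff₀ hx.1]
  linarith

end LogConcave

/-- Geometric convergence under a Doeblin minorization on the support of a stationary
distribution. -/
lemma half_sum_abs_pow_sub_le {α : Type*} [Fintype α] [DecidableEq α] (P : Matrix α α ℝ)
    (μ : α → ℝ) (hμ0 : ∀ a, 0 ≤ μ a) (hμ1 : ∑ a, μ a = 1)
    (hrow : ∀ a, μ a ≠ 0 → ∑ b, P a b = 1) (hstat : ∀ b, ∑ a, μ a * P a b = μ b)
    (hsupp : ∀ a b, μ a ≠ 0 → μ b = 0 → P a b = 0)
    (hmin : ∀ a b, μ a ≠ 0 → (1 / 2) * μ b ≤ P a b) {a₀ : α} (ha₀ : μ a₀ ≠ 0) (s : ℕ) :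
    (∀ b, μ b = 0 → (P ^ s) a₀ b = 0) ∧ ∑ b, (P ^ s) a₀ b = 1 ∧
      (1 / 2) * ∑ b, |(P ^ s) a₀ b - μ b| ≤ (1 / 2) ^ s := by
  induction s with
  | zero =>
    refine ⟨?_, by simp [Matrix.one_apply], ?_⟩
    · intro b hb
      rw [pow_zero, Matrix.one_apply_ne]
      rintro rfl
      exact ha₀ hb
    · have h : ∑ b, |(P ^ 0) a₀ b - μ b| ≤ ∑ b, ((1 : Matrix α α ℝ) a₀ b + μ b) := by
        refine Finset.sum_le_sum fun b _ => ?_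
        rw [pow_zero]
        have h1 : 0 ≤ (1 : Matrix α α ℝ) a₀ b := by
          rw [Matrix.one_apply]; split_ifs <;> norm_num
        rw [abs_le]
        constructor <;> linarith [hμ0 b]
      rw [Finset.sum_add_distrib, hμ1] at h
      simp only [Matrix.one_apply, Finset.sum_ite_eq, Finset.mem_univ, if_true] at h
      rw [pow_zero ((1 : ℝ) / 2)]
      linarith
  | succ s ih =>
    obtain ⟨h0, h1, h2⟩ := ih
    have hmul : ∀ b, (P ^ (s + 1)) a₀ b = ∑ a, (P ^ s) a₀ a * P a b := by
      intro b
      rw [pow_succ, Matrix.mul_apply]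
    refine ⟨?_, ?_, ?_⟩
    · intro b hb
      rw [hmul]
      refine Finset.sum_eq_zero fun a _ => ?_
      by_cases ha : μ a = 0
      · rw [h0 a ha, zero_mul]
      · rw [hsupp a b ha hb, mul_zero]
    · simp only [hmul]
      rw [Finset.sum_comm, ← h1]
      refine Finset.sum_congr rfl fun a _ => ?_
      rw [← Finset.mul_sum]
      by_cases ha : μ a = 0
      · rw [h0 a ha, zero_mul]
      · rw [hrow a ha, mul_one]
    · have hdiff : ∀ b, (P ^ (s + 1)) a₀ b - μ b =
          ∑ a, ((P ^ s) a₀ a - μ a) * (P a b - (1 / 2) * μ b) := by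
        intro b
        have h3 : ∑ a, ((P ^ s) a₀ a - μ a) * ((1 / 2) * μ b) = 0 := by
          rw [← Finset.sum_mul, Finset.sum_sub_distrib, h1, hμ1, sub_self, zero_mul]
        simp only [mul_sub (_ - _)]
        rw [Finset.sum_sub_distrib, h3, sub_zero]
        simp only [sub_mul]
        rw [Finset.sum_sub_distrib, hstat, hmul]
      have hbound : ∑ b, |(P ^ (s + 1)) a₀ b - μ b| ≤
          ∑ a, |(P ^ s) a₀ a - μ a| * (1 / 2) := by
        calc _ ≤ ∑ b, ∑ a, |(P ^ s) a₀ a - μ a| * (P a b - (1 / 2) * μ b) := by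
              refine Finset.sum_le_sum fun b _ => ?_
              rw [hdiff]
              refine (Finset.abs_sum_le_sum_abs _ _).trans (Finset.sum_le_sum fun a _ => ?_)
              by_cases ha : μ a = 0
              · simp [h0 a ha, ha]
              · rw [abs_mul, abs_of_nonneg (sub_nonneg.2 (hmin a b ha))]
          _ = _ := by
              rw [Finset.sum_comm]
              refine Finset.sum_congr rfl fun a _ => ?_
              by_cases ha : μ a = 0
              · simp [h0 a ha, ha]
              · rw [← Finset.mul_sum, Finset.sum_sub_distrib, hrow a ha, ← Finset.mul_sum, hμ1]
                norm_num
      rw [← Finset.sum_mul] at hbound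
      rw [pow_succ ((1 : ℝ) / 2)]
      linarith

lemma sum_indVec {n : ℕ} (S : Finset (Fin n)) : ∑ i, (indVec S i : ℝ) = #S := by
  simp [indVec]

lemma half_mul_le_kernel {n k : ℕ} (hk : 1 ≤ k) {μ : Finset (Fin n) → ℝ}
    (hμ : IsProbDistOn n k μ) (hlc : IsLogConcaveOn n (genPoly n k μ)) {p : Fin n → ℝ}
    (hp : ∀ i, 0 < p i) (hp1 : ∑ i, p i = 1) {t : ℕ} (ht : 20 * (k : ℝ) ^ 2 ≤ (t : ℝ))
    (hmarg : ∀ i, (1 + 1 / (20 * (k : ℝ)))⁻¹ * marginal n μ i ≤ (k : ℝ) * p i)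
    {S₀ : Finset (Fin n)} (hS₀ : μ S₀ ≠ 0) (S₁ : Finset (Fin n)) :
    (1 / 2) * μ S₁ ≤ kernel n k t μ p S₀ S₁ := by
  by_cases hS₁ : μ S₁ = 0
  · rw [hS₁, kernel_eq_zero hμ.2.1 hp t hS₀ hS₁, mul_zero]
  have hc₀ : #S₀ = k := by_contra fun h => hS₀ (hμ.2.1 _ h)
  have hc₁ : #S₁ = k := by_contra fun h => hS₁ (hμ.2.1 _ h)
  have hkR : (1 : ℝ) ≤ k := by exact_mod_cast hk
  have ht' : 20 * k ^ 2 ≤ t := by exact_mod_cast ht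
  obtain ⟨m, rfl⟩ : ∃ m, t = m + k := by
    have : k ≤ k ^ 2 := Nat.le_self_pow (by norm_num) k
    exact ⟨t - k, by omega⟩
  push_cast at ht
  have hm19 : 19 * (k : ℝ) ^ 2 ≤ m := by nlinarith
  have hmR : (0 : ℝ) < m := by nlinarith
  have hv : ∀ i, 0 ≤ (((indVec S₀ + indVec S₁) i : ℕ) : ℝ) / ((m : ℝ) * p i) := fun i =>
    div_nonneg (Nat.cast_nonneg _) (mul_pos hmR (hp i)).le
  have hg := genPoly_one_add_le_exp hμ hlc hv
  have hfac : 0 < 1 + 1 / (20 * (k : ℝ)) := by positivity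
  have hsum : ∑ i, marginal n μ i * ((((indVec S₀ + indVec S₁) i : ℕ) : ℝ) / ((m : ℝ) * p i)) ≤
      1 / 2 := by
    have h1 : ∀ i, marginal n μ i * ((((indVec S₀ + indVec S₁) i : ℕ) : ℝ) / ((m : ℝ) * p i)) ≤
        ((1 + 1 / (20 * (k : ℝ))) * k / m) * ((indVec S₀ i : ℝ) + indVec S₁ i) := by
      intro i
      have h2 := hmarg i
      rw [inv_mul_le_iff₀ hfac] at h2
      have h3 := mul_le_mul_of_nonneg_right h2 (hv i)
      refine h3.trans (le_of_eq ?_)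
      have := (hp i).ne'
      simp only [Pi.add_apply]
      push_cast
      field_simp
    refine (Finset.sum_le_sum fun i _ => h1 i).trans ?_
    rw [← Finset.mul_sum, Finset.sum_add_distrib, sum_indVec, sum_indVec, hc₀, hc₁]
    have h4 : (1 + 1 / (20 * (k : ℝ))) * k / m * (k + k) = (2 * k ^ 2 + k / 10) / m := by
      field_simp
      ring
    rw [h4, div_le_iff₀ hmR]
    nlinarith
  have hexp : Real.exp (1 / 2) ≤ 2 := by
    rw [← Real.le_log_iff_exp_le (by norm_num)]
    linarith [Real.log_two_gt_d9]
  have := mul_le_kernel hμ.1 hμ.2.1 hp hp1 m (by exact_mod_cast hmR) hS₀ hS₁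
    (C := 2) (by norm_num) ((hg.trans (Real.exp_le_exp.2 hsum)).trans hexp)
  linarith

theorem multi_step_mixing
    (n k : ℕ) (hk : 1 ≤ k) (hkn : k ≤ n)
    (μ : Finset (Fin n) → ℝ) (hμ : IsProbDistOn n k μ)
    (hlc : IsLogConcaveOn n (genPoly n k μ))
    (p : Fin n → ℝ) (hp : ∀ i, 0 < p i) (hp1 : ∑ i : Fin n, p i = 1)
    (t : ℕ) (ht : 20 * (k : ℝ) ^ 2 ≤ (t : ℝ))
    (hmarg : ∀ i, (1 + 1 / (20 * (k : ℝ)))⁻¹ * marginal n μ i ≤ (k : ℝ) * p i)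
    (s : ℕ) (hs : 1 ≤ s)
    (S₀ : Finset (Fin n)) (hS₀ : μ S₀ ≠ 0) :
    (1 / 2) * ∑ S₁ : Finset (Fin n),
        |(kernelMatrix n k t μ p ^ s) S₀ S₁ - μ S₁| ≤ (2 : ℝ) ^ (-(s : ℤ)) := by
  have hP : ∀ S T, kernelMatrix n k t μ p S T = kernel n k t μ p S T := fun _ _ => rfl
  have h := (half_sum_abs_pow_sub_le (kernelMatrix n k t μ p) μ hμ.1 hμ.2.2
    (fun S hS => sum_kernel hμ.1 hμ.2.1 hp hp1 t hS)
    (fun T => sum_mul_kernel hμ.1 hμ.2.1 hp hp1 t T)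
    (fun S T hS hT => kernel_eq_zero hμ.2.1 hp t hS hT)
    (fun S T hS => half_mul_le_kernel hk hμ hlc hp hp1 ht hmarg hS T) hS₀ s).2.2
  rw [zpow_neg, zpow_natCast, ← inv_pow]
  simpa only [one_div] using h
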